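/- arXiv:1505.05827 — 2 statements merged into one kernel-verified Lean document; each statement's English description precedes it below -/
import Mathlib

section
/- Let U ⊆ ℝ^{2n} be open, let B : U → M_{2n}(ℝ) be a C¹ structure matrix with B(z) invertible for all z ∈ U, let H : U → ℝ be of class C², and let c : U → ℝ^{2n} be of class C² with B(z)^{-1} = Dc(z)^T − Dc(z) for all z ∈ U, where (Dc(z))_{ij} = ∂c_i/∂z_j. Let ω ∈ ℝ^n, let K : ℝ^n → U be C² and ℤ^n-periodic, and define the error function e(θ) = B(K(θ))∇H(K(θ)) − ∂_ω K(θ). Then ∫_{[0,1]^n} DK(θ)^T B(K(θ))^{-1} e(θ) dθ = 0, i.e., each component of the ℤ^n-periodic map θ ↦ DK(θ)^T B(K(θ))^{-1} e(θ) has zero average over the torus. -/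
open MeasureTheory Matrix

/-- The gradient of `H : ℝ^d → ℝ`, with entries `∂H/∂z_i`. -/
noncomputable def pgrad {d : ℕ} (H : (Fin d → ℝ) → ℝ) (z : Fin d → ℝ) : Fin d → ℝ :=
  fun i => fderiv ℝ H z (Pi.single i 1)

/-- The Jacobian matrix of `f : ℝ^a → ℝ^b`, with entries `∂f_i/∂z_j`. -/
noncomputable def pjac {a b : ℕ} (f : (Fin a → ℝ) → (Fin b → ℝ)) (z : Fin a → ℝ) :
    Matrix (Fin b) (Fin a) ℝ :=
  Matrix.of fun i j => fderiv ℝ f z (Pi.single j 1) i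

/-- A directional derivative of a `C¹` function that is `ℤⁿ`-periodic has zero average over the
unit cube. -/
theorem integral_fderiv_eq_zero_of_periodic {n : ℕ} {F : (Fin n → ℝ) → ℝ}
    (hF : ContDiff ℝ 1 F)
    (hper : ∀ (θ : Fin n → ℝ) (k : Fin n → ℤ), F (θ + fun i => (k i : ℝ)) = F θ)
    (v : Fin n → ℝ) :
    ∫ θ in Set.Icc (0 : Fin n → ℝ) 1, fderiv ℝ F θ v = 0 := by
  cases n with
  | zero =>
    obtain rfl : v = 0 := Subsingleton.elim _ _
    simp only [map_zero, integral_zero]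
  | succ n =>
    have hsum : ∀ θ, fderiv ℝ F θ v
        = ∑ i, (v i • fderiv ℝ F θ) (Pi.single i 1) := by
      intro θ
      conv_lhs => rw [pi_eq_sum_univ' v]
      simp [map_sum]
    have hcont : Continuous fun θ => fderiv ℝ F θ v :=
      (hF.continuous_fderiv one_ne_zero).clm_apply continuous_const
    have hint := hcont.continuousOn.integrableOn_compact (μ := volume)
      (isCompact_Icc (a := (0 : Fin (n + 1) → ℝ)) (b := 1))
    simp_rw [hsum] at hint ⊢
    rw [integral_divergence_of_hasFDerivAt_off_countable' (0 : Fin (n + 1) → ℝ) 1 zero_le_one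
      (fun i θ => v i • F θ) (fun i θ => v i • fderiv ℝ F θ) ∅ Set.countable_empty
      (fun i => (hF.continuous.const_smul (v i)).continuousOn)
      (fun θ _ i => ((hF.differentiable one_ne_zero) θ).hasFDerivAt.const_smul (v i)) hint]
    refine Finset.sum_eq_zero fun i _ => sub_eq_zero.2 ?_
    refine integral_congr_ae (Filter.Eventually.of_forall fun x => ?_)
    have hface : (i.insertNth 1 x : Fin (n + 1) → ℝ)
        = i.insertNth 0 x + fun j => ((Pi.single i 1 : Fin (n + 1) → ℤ) j : ℝ) := by
      ext j
      refine Fin.succAboveCases i ?_ (fun j => ?_) j <;> simp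
    change v i • F (i.insertNth 1 x) = v i • F (i.insertNth 0 x)
    rw [hface, hper]

/-- Differentiating a periodic function gives a periodic function. -/
theorem fderiv_add_of_periodic {E F : Type*} [NormedAddCommGroup E] [NormedSpace ℝ E]
    [NormedAddCommGroup F] [NormedSpace ℝ F] {f : E → F} {p : E}
    (hf : ∀ x, f (x + p) = f x) (x : E) : fderiv ℝ f (x + p) = fderiv ℝ f x := by
  rw [← fderiv_comp_add_right]
  simp_rw [hf]

theorem pjac_mulVec {a b : ℕ} (f : (Fin a → ℝ) → (Fin b → ℝ)) (z v : Fin a → ℝ) :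
    (pjac f z).mulVec v = fderiv ℝ f z v := by
  conv_rhs => rw [pi_eq_sum_univ' v]
  ext i
  simp [pjac, Matrix.mulVec, dotProduct, map_sum, mul_comm]

theorem pgrad_dotProduct {d : ℕ} (H : (Fin d → ℝ) → ℝ) (z v : Fin d → ℝ) :
    pgrad H z ⬝ᵥ v = fderiv ℝ H z v := by
  conv_rhs => rw [pi_eq_sum_univ' v]
  simp [pgrad, dotProduct, map_sum, mul_comm]

/-- The entry `j` of `(Df)ᵀ w` is the pairing of `∂_j f` with `w`. -/
theorem transpose_pjac_mulVec_apply {a b : ℕ} (f : (Fin a → ℝ) → (Fin b → ℝ))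
    (z : Fin a → ℝ) (w : Fin b → ℝ) (j : Fin a) :
    (pjac f z)ᵀ.mulVec w j = w ⬝ᵥ fderiv ℝ f z (Pi.single j 1) := by
  simp [pjac, Matrix.mulVec, dotProduct, mul_comm]

theorem ContDiff.dotProduct_fun {E : Type*} [NormedAddCommGroup E] [NormedSpace ℝ E] {d : ℕ}
    {k : WithTop ℕ∞} {f g : E → Fin d → ℝ} (hf : ContDiff ℝ k f) (hg : ContDiff ℝ k g) :
    ContDiff ℝ k fun x => f x ⬝ᵥ g x :=
  ContDiff.sum fun i _ => (contDiff_pi.1 hf i).mul (contDiff_pi.1 hg i)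

theorem fderiv_dotProduct_apply {E : Type*} [NormedAddCommGroup E] [NormedSpace ℝ E] {d : ℕ}
    {f g : E → Fin d → ℝ} {x : E} (hf : DifferentiableAt ℝ f x) (hg : DifferentiableAt ℝ g x)
    (v : E) :
    fderiv ℝ (fun y => f y ⬝ᵥ g y) x v
      = fderiv ℝ f x v ⬝ᵥ g x + f x ⬝ᵥ fderiv ℝ g x v := by
  have h : HasFDerivAt (fun y => f y ⬝ᵥ g y)
      (∑ i, (f x i • (ContinuousLinearMap.proj i).comp (fderiv ℝ g x)
        + g x i • (ContinuousLinearMap.proj i).comp (fderiv ℝ f x))) x :=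
    HasFDerivAt.fun_sum fun i _ =>
      (hasFDerivAt_pi'.1 hf.hasFDerivAt i).mul (hasFDerivAt_pi'.1 hg.hasFDerivAt i)
  rw [h.fderiv]
  simp [dotProduct, Finset.sum_add_distrib, mul_comm, add_comm]

/-- Pulling back the one-form `a · dK` and using the symmetry of second derivatives:
`∂_v (a · ∂_w K) - ∂_w (a · ∂_v K) = ∂_v a · ∂_w K - ∂_w a · ∂_v K`. -/
theorem fderiv_dotProduct_fderiv_sub {E : Type*} [NormedAddCommGroup E] [NormedSpace ℝ E] {d : ℕ}
    {a K : E → Fin d → ℝ} (ha : Differentiable ℝ a) (hK : ContDiff ℝ 2 K) (x v w : E) :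
    fderiv ℝ (fun y => a y ⬝ᵥ fderiv ℝ K y w) x v - fderiv ℝ (fun y => a y ⬝ᵥ fderiv ℝ K y v) x w
      = fderiv ℝ a x v ⬝ᵥ fderiv ℝ K x w - fderiv ℝ a x w ⬝ᵥ fderiv ℝ K x v := by
  have hdK : Differentiable ℝ (fderiv ℝ K) :=
    (hK.fderiv_right (m := 1) (by norm_num)).differentiable one_ne_zero
  have hd : ∀ u, Differentiable ℝ fun y => fderiv ℝ K y u :=
    fun u y => (hdK y).clm_apply (differentiableAt_const u)
  have hsnd : ∀ u t, fderiv ℝ (fun y => fderiv ℝ K y u) x t = fderiv ℝ (fderiv ℝ K) x t u := by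
    intro u t
    rw [fderiv_clm_apply (hdK x) (differentiableAt_const u)]
    simp
  have hsymm : IsSymmSndFDerivAt ℝ K x := hK.contDiffAt.isSymmSndFDerivAt (by simp)
  rw [fderiv_dotProduct_apply (ha x) (hd w x), fderiv_dotProduct_apply (ha x) (hd v x),
    hsnd, hsnd, hsymm.eq v w]
  ring

/-- For a `C¹` invertible structure matrix `B` with exact inverse
(`B⁻¹ = Dcᵀ − Dc` for a `C²` map `c`), a `C²` Hamiltonian `H`, any `ω ∈ ℝⁿ` and any
`C²` `ℤⁿ`-periodic `K : ℝⁿ → U`, the error `e(θ) = B(K(θ))∇H(K(θ)) − ∂_ω K(θ)`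
satisfies `∫_{[0,1]ⁿ} DK(θ)ᵀ B(K(θ))⁻¹ e(θ) dθ = 0`. -/
theorem stmt_7 {n : ℕ} (U : Set (Fin (2 * n) → ℝ)) (hU : IsOpen U)
    (B : (Fin (2 * n) → ℝ) → Matrix (Fin (2 * n)) (Fin (2 * n)) ℝ)
    (hB : ∀ i j, ContDiffOn ℝ 1 (fun z => B z i j) U)
    (hskew : ∀ z ∈ U, ∀ i j, B z i j = - B z j i)
    (hjacobi : ∀ z ∈ U, ∀ i j k,
      ∑ l, (fderiv ℝ (fun w => B w i j) z (Pi.single l 1) * B z l k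
          + fderiv ℝ (fun w => B w j k) z (Pi.single l 1) * B z l i
          + fderiv ℝ (fun w => B w k i) z (Pi.single l 1) * B z l j) = 0)
    (hBunit : ∀ z ∈ U, IsUnit (B z))
    (H : (Fin (2 * n) → ℝ) → ℝ) (hH : ContDiffOn ℝ 2 H U)
    (c : (Fin (2 * n) → ℝ) → (Fin (2 * n) → ℝ)) (hc : ContDiffOn ℝ 2 c U)
    (hexact : ∀ z ∈ U, (B z)⁻¹ = (pjac c z)ᵀ - pjac c z)
    (ω : Fin n → ℝ)
    (K : (Fin n → ℝ) → (Fin (2 * n) → ℝ)) (hK : ContDiff ℝ 2 K)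
    (hKU : ∀ θ, K θ ∈ U)
    (hKper : ∀ (θ : Fin n → ℝ) (k : Fin n → ℤ), K (θ + fun i => (k i : ℝ)) = K θ) :
    (∫ θ in Set.Icc (0 : Fin n → ℝ) 1,
        (pjac K θ)ᵀ.mulVec (((B (K θ))⁻¹).mulVec
          ((B (K θ)).mulVec (pgrad H (K θ)) - fderiv ℝ K θ ω))) = 0 := by
  have hHK : ContDiff ℝ 2 fun θ => H (K θ) := hH.comp_contDiff hK hKU
  have hcK : ContDiff ℝ 2 fun θ => c (K θ) := hc.comp_contDiff hK hKU
  have hdK : ∀ v, ContDiff ℝ 1 fun θ => fderiv ℝ K θ v := fun v =>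
    (hK.fderiv_right (m := 1) (by norm_num)).clm_apply contDiff_const
  have hdKper : ∀ (θ : Fin n → ℝ) (k : Fin n → ℤ),
      fderiv ℝ K (θ + fun i => (k i : ℝ)) = fderiv ℝ K θ :=
    fun θ k => fderiv_add_of_periodic (fun x => hKper x k) θ
  have hP : ∀ v, ContDiff ℝ 1 fun θ => c (K θ) ⬝ᵥ fderiv ℝ K θ v := fun v =>
    (hcK.of_le one_le_two).dotProduct_fun (hdK v)
  have hG : ContDiff ℝ 1 fun θ => H (K θ) - c (K θ) ⬝ᵥ fderiv ℝ K θ ω :=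
    (hHK.of_le one_le_two).sub (hP ω)
  have hKd : Differentiable ℝ K := hK.differentiable two_ne_zero
  have hentry : ∀ (j : Fin n) (θ : Fin n → ℝ),
      (pjac K θ)ᵀ.mulVec (((B (K θ))⁻¹).mulVec
        ((B (K θ)).mulVec (pgrad H (K θ)) - fderiv ℝ K θ ω)) j
      = fderiv ℝ (fun θ => H (K θ) - c (K θ) ⬝ᵥ fderiv ℝ K θ ω) θ (Pi.single j 1)
        + fderiv ℝ (fun θ => c (K θ) ⬝ᵥ fderiv ℝ K θ (Pi.single j 1)) θ ω := by
    intro j θ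
    have hHd : DifferentiableAt ℝ H (K θ) :=
      (hH.contDiffAt (hU.mem_nhds (hKU θ))).differentiableAt two_ne_zero
    have hcd : DifferentiableAt ℝ c (K θ) :=
      (hc.contDiffAt (hU.mem_nhds (hKU θ))).differentiableAt two_ne_zero
    have hHchain : ∀ v, fderiv ℝ (fun θ => H (K θ)) θ v = fderiv ℝ H (K θ) (fderiv ℝ K θ v) := fun v =>
      congrArg (fun L => L v) (fderiv_comp θ hHd (hKd θ))
    have hcchain : ∀ v, fderiv ℝ (fun θ => c (K θ)) θ v = fderiv ℝ c (K θ) (fderiv ℝ K θ v) := fun v =>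
      congrArg (fun L => L v) (fderiv_comp θ hcd (hKd θ))
    have hcurl := fderiv_dotProduct_fderiv_sub (hcK.differentiable two_ne_zero) hK θ
      (Pi.single j 1) ω
    have hcancel : (B (K θ))⁻¹.mulVec ((B (K θ)).mulVec (pgrad H (K θ))) = pgrad H (K θ) := by
      rw [Matrix.mulVec_mulVec, Matrix.nonsing_inv_mul _
        ((Matrix.isUnit_iff_isUnit_det _).1 (hBunit _ (hKU θ))), Matrix.one_mulVec]
    rw [fderiv_fun_sub (hHK.differentiable two_ne_zero θ) ((hP ω).differentiable one_ne_zero θ),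
      _root_.sub_apply, hHchain, Matrix.mulVec_sub, hcancel,
      hexact _ (hKU θ), transpose_pjac_mulVec_apply, sub_dotProduct, pgrad_dotProduct,
      Matrix.sub_mulVec, sub_dotProduct, Matrix.mulVec_transpose, ← Matrix.dotProduct_mulVec,
      pjac_mulVec, pjac_mulVec]
    rw [hcchain, hcchain] at hcurl
    have hcomm := dotProduct_comm (fderiv ℝ K θ ω) (fderiv ℝ c (K θ) (fderiv ℝ K θ (Pi.single j 1)))
    linarith
  have hint : ∀ {F : (Fin n → ℝ) → ℝ} (_ : ContDiff ℝ 1 F) (v : Fin n → ℝ),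
      IntegrableOn (fun θ => fderiv ℝ F θ v) (Set.Icc (0 : Fin n → ℝ) 1) := fun hF v =>
    ((hF.continuous_fderiv one_ne_zero).clm_apply continuous_const).continuousOn.integrableOn_compact
      isCompact_Icc
  ext j
  rw [eval_integral fun j => by
    simp_rw [hentry j]
    exact (hint hG _).add (hint (hP _) _)]
  simp_rw [hentry j]
  rw [integral_add (hint hG _) (hint (hP _) _),
    integral_fderiv_eq_zero_of_periodic hG (fun θ k => by simp only [hKper, hdKper]),
    integral_fderiv_eq_zero_of_periodic (hP _) (fun θ k => by simp only [hKper, hdKper])]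
  simp
end

section
/- Let γ > 0, σ > 0, and let ω ∈ ℝ^n be (γ,σ)-Diophantine. Let S⁰ : ℝ^n → M_n(ℝ) be real analytic and ℤ^n-periodic with invertible average ⟨S⁰⟩ = ∫_{[0,1]^n} S⁰(θ)dθ, and let p_x, p_y : ℝ^n → ℝ^n be real analytic and ℤ^n-periodic with ∫_{[0,1]^n} p_y(θ)dθ = 0. Then there exist real analytic ℤ^n-periodic maps ξ_x, ξ_y : ℝ^n → ℝ^n solving the triangular system ∂_ω ξ_y(θ) = −p_y(θ) and ∂_ω ξ_x(θ) = S⁰(θ)ξ_y(θ) − p_x(θ) for all θ ∈ ℝ^n. -/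
open MeasureTheory

/-- `ω ∈ ℝⁿ` is `(γ, σ)`-Diophantine. -/
def IsDiophantine {n : ℕ} (γ σ : ℝ) (ω : Fin n → ℝ) : Prop :=
  ∀ k : Fin n → ℤ, k ≠ 0 →
    γ * (∑ i, |(k i : ℝ)|) ^ (-σ) ≤ |∑ i, (k i : ℝ) * ω i|

open scoped NNReal ENNReal

/-- A real analytic function on a compact set has power series expansions with a common radius and
uniformly geometric coefficients. -/
theorem exists_uniform_powerSeries_bound {E F : Type*} [NormedAddCommGroup E] [NormedSpace ℝ E]
    [NormedAddCommGroup F] [NormedSpace ℝ F] [CompleteSpace F] {f : E → F} {K : Set E}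
    (hK : IsCompact K) (hf : ∀ x ∈ K, AnalyticAt ℝ f x) :
    ∃ r C : ℝ≥0, 0 < r ∧ ∀ y ∈ K, ∃ q : FormalMultilinearSeries ℝ E F,
      HasFPowerSeriesOnBall f q y r ∧ ∀ m, ‖q m‖₊ * r ^ m ≤ C := by
  refine hK.induction_on (p := fun s => ∃ r C : ℝ≥0, 0 < r ∧ ∀ y ∈ s,
    ∃ q : FormalMultilinearSeries ℝ E F,
      HasFPowerSeriesOnBall f q y r ∧ ∀ m, ‖q m‖₊ * r ^ m ≤ C) ?_ ?_ ?_ ?_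
  · exact ⟨1, 0, one_pos, by simp⟩
  · rintro s t hst ⟨r, C, hr, h⟩
    exact ⟨r, C, hr, fun y hy => h y (hst hy)⟩
  · rintro s t ⟨r, C, hr, h⟩ ⟨r', C', hr', h'⟩
    refine ⟨min r r', max C C', lt_min hr hr', ?_⟩
    rintro y (hy | hy)
    · obtain ⟨q, hq, hb⟩ := h y hy
      refine ⟨q, hq.mono (by simp [hr, hr']) (by simp), fun m => ?_⟩
      refine le_trans ?_ ((hb m).trans (le_max_left _ _))
      gcongr
      exact min_le_left _ _
    · obtain ⟨q, hq, hb⟩ := h' y hy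
      refine ⟨q, hq.mono (by simp [hr, hr']) (by simp), fun m => ?_⟩
      refine le_trans ?_ ((hb m).trans (le_max_right _ _))
      gcongr
      exact min_le_right _ _
  · intro x hx
    obtain ⟨p, R, hp⟩ := hf x hx
    obtain ⟨ρ, hρ0, hρ⟩ := ENNReal.lt_iff_exists_nnreal_btwn.1 hp.r_pos
    have hρ0' : 0 < ρ := by simpa using hρ0
    set r : ℝ≥0 := ρ / 2 with hr
    have hr0 : 0 < r := by positivity
    have hrr : (r + r : ℝ≥0∞) < R := by
      rw [← ENNReal.coe_add, hr, add_halves]; exact hρ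
    have hrad : (r + r : ℝ≥0∞) < p.radius := hrr.trans_le hp.r_le
    have hsum := p.changeOriginSeries_summable_aux₁ hrad
    have hsum' := NNReal.summable_sigma.1 hsum
    refine ⟨Metric.ball x r, mem_nhdsWithin_of_mem_nhds (Metric.ball_mem_nhds _ (by simpa using hr0)),
      r, ∑' s : Σ k l : ℕ, { s : Finset (Fin (k + l)) // s.card = l },
      ‖p (s.1 + s.2.1)‖₊ * r ^ s.2.1 * r ^ s.1, hr0, fun y hy => ?_⟩
    have hy' : ‖y - x‖₊ < r := by
      rw [← NNReal.coe_lt_coe]; simpa [dist_eq_norm] using hy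
    have hyR : (‖y - x‖₊ : ℝ≥0∞) + r < R :=
      lt_of_le_of_lt (by gcongr) hrr
    refine ⟨p.changeOrigin (y - x), ?_, fun m => ?_⟩
    · have := hp.changeOrigin (y := y - x) (lt_of_le_of_lt le_self_add hyR)
      rw [add_sub_cancel] at this
      refine this.mono (by simpa using hr0) ?_
      exact (ENNReal.le_sub_of_add_le_left (by simp) hyR.le)
    · have h1 := p.nnnorm_changeOrigin_le (x := y - x) m
        ((lt_of_le_of_lt le_self_add hyR).trans_le hp.r_le)
      have h2 := p.changeOriginSeries_summable_aux₂ (r := r) (lt_of_le_of_lt le_self_add hrad) m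
      have h3 : ‖p.changeOrigin (y - x) m‖₊ ≤
          ∑' s : Σ l : ℕ, { s : Finset (Fin (m + l)) // s.card = l }, ‖p (m + s.1)‖₊ * r ^ s.1 := by
        refine h1.trans (Summable.tsum_le_tsum (fun s => by gcongr) ?_ h2)
        exact NNReal.summable_of_le (fun s => by gcongr) h2
      calc _ ≤ (∑' s : Σ l : ℕ, { s : Finset (Fin (m + l)) // s.card = l },
              ‖p (m + s.1)‖₊ * r ^ s.1) * r ^ m := by gcongr
        _ = ∑' s : Σ l : ℕ, { s : Finset (Fin (m + l)) // s.card = l },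
              ‖p (m + s.1)‖₊ * r ^ s.1 * r ^ m := NNReal.tsum_mul_right .. |>.symm
        _ ≤ _ := by
          rw [hsum.tsum_sigma' hsum'.1]
          exact hsum'.2.le_tsum m (fun _ _ => zero_le)

theorem summable_prod_pi {n : ℕ} {g : ℤ → ℝ} (hg0 : ∀ k, 0 ≤ g k) (hg : Summable g) :
    Summable fun k : Fin n → ℤ => ∏ i, g (k i) := by
  induction n with
  | zero => exact Summable.of_finite
  | succ n ih =>
    rw [← (Fin.consEquiv fun _ : Fin (n + 1) => ℤ).summable_iff]
    simpa [Function.comp_def, Fin.prod_univ_succ] using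
      hg.mul_of_nonneg ih hg0 (fun k => Finset.prod_nonneg fun i _ => hg0 _)

theorem summable_exp_neg_sum_abs {n : ℕ} {ρ : ℝ} (hρ : 0 < ρ) :
    Summable fun k : Fin n → ℤ => Real.exp (-ρ * ∑ i, |(k i : ℝ)|) := by
  have h : Summable fun k : ℤ => Real.exp (-ρ * |(k : ℝ)|) := by
    have h1 : Summable fun k : ℕ => Real.exp (-ρ * k) := by
      simpa [mul_comm] using Real.summable_exp_nat_mul_iff.2 (neg_lt_zero.2 hρ)
    exact Summable.of_nat_of_neg (by simpa using h1) (by simpa using h1)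
  refine (summable_prod_pi (fun k => (Real.exp_pos _).le) h).congr fun k => ?_
  rw [← Real.exp_sum, Finset.mul_sum]

/-- A series of functions with power series expansions on a common ball may be summed term by
term when the coefficient norms are jointly summable. -/
theorem hasFPowerSeriesOnBall_tsum {ι E F : Type*} [NormedAddCommGroup E] [NormedSpace ℝ E]
    [NormedAddCommGroup F] [NormedSpace ℝ F] [CompleteSpace F]
    {f : ι → E → F} {u : ι → FormalMultilinearSeries ℝ E F} {x : E} {r : ℝ≥0} (hr : 0 < r)
    (hf : ∀ k, HasFPowerSeriesOnBall (f k) (u k) x r)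
    (hu : Summable fun q : ι × ℕ => ‖u q.1 q.2‖ * (r : ℝ) ^ q.2) :
    HasFPowerSeriesOnBall (fun y => ∑' k, f k y) (fun m => ∑' k, u k m) x r := by
  have hr' : (0 : ℝ) < r := hr
  have hcol (m : ℕ) : Summable fun k => ‖u k m‖ := by
    have := hu.comp_injective (i := fun k : ι => (k, m)) (fun a b h => (Prod.ext_iff.1 h).1)
    exact (summable_mul_right_iff (pow_ne_zero m hr'.ne')).1 this
  refine ⟨?_, by simpa using hr, fun {y} hy => ?_⟩
  · refine FormalMultilinearSeries.le_radius_of_bound _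
      (∑' q : ι × ℕ, ‖u q.1 q.2‖ * (r : ℝ) ^ q.2) fun m => ?_
    have hinj : Function.Injective (fun k : ι => (k, m)) := fun a b h => (Prod.ext_iff.1 h).1
    calc ‖∑' k, u k m‖ * (r : ℝ) ^ m ≤ (∑' k, ‖u k m‖) * (r : ℝ) ^ m := by
          gcongr; exact norm_tsum_le_tsum_norm (hcol m)
      _ = ∑' k, ‖u k m‖ * (r : ℝ) ^ m := tsum_mul_right.symm
      _ ≤ _ := tsum_comp_le_tsum_of_inj hu (fun q => by positivity) hinj
  · have hy' : ‖y‖ ≤ r := by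
      have : ‖y‖ < r := by simpa using hy
      exact this.le
    have hs : Summable fun q : ι × ℕ => u q.1 q.2 fun _ => y := by
      refine hu.of_norm_bounded fun q => ?_
      refine ((u q.1 q.2).le_opNorm _).trans ?_
      simp only [Finset.prod_const, Finset.card_univ, Fintype.card_fin]
      gcongr
    have h1 := hs.hasSum.prod_fiberwise fun k => (hf k).hasSum hy
    rw [h1.tsum_eq]
    have h2 := (Equiv.prodComm ℕ ι).hasSum_iff.2 hs.hasSum
    refine h2.prod_fiberwise fun m => ?_
    exact (ContinuousMultilinearMap.apply ℝ (fun _ : Fin m => E) F (fun _ => y)).hasSum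
      (hcol m).of_norm.hasSum

/-- The linear form `v ↦ 2πi k·v`. -/
noncomputable def freqForm {n : ℕ} (k : Fin n → ℤ) : (Fin n → ℝ) →L[ℝ] ℂ :=
  ∑ j, (2 * Real.pi * Complex.I * (k j : ℂ)) •
    Complex.ofRealCLM.comp (ContinuousLinearMap.proj (R := ℝ) (φ := fun _ : Fin n => ℝ) j)

theorem freqForm_apply {n : ℕ} (k : Fin n → ℤ) (v : Fin n → ℝ) :
    freqForm k v = 2 * Real.pi * Complex.I * ((∑ j, (k j : ℝ) * v j : ℝ) : ℂ) := by
  simp [freqForm, Finset.mul_sum, mul_assoc]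

theorem norm_freqForm_le {n : ℕ} (k : Fin n → ℤ) :
    ‖freqForm k‖ ≤ 2 * Real.pi * ∑ j, |(k j : ℝ)| := by
  refine ContinuousLinearMap.opNorm_le_bound _ (by positivity) fun v => ?_
  rw [freqForm_apply]
  simp only [norm_mul, Complex.norm_ofNat, Complex.norm_real, Complex.norm_I, mul_one,
    Real.norm_eq_abs, abs_of_pos Real.pi_pos]
  rw [mul_assoc (2 * Real.pi), Finset.sum_mul]
  gcongr
  refine (Finset.abs_sum_le_sum_abs _ _).trans (Finset.sum_le_sum fun j _ => ?_)
  rw [abs_mul]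
  gcongr
  exact norm_le_pi_norm v j

theorem norm_exp_freqForm {n : ℕ} (k : Fin n → ℤ) (v : Fin n → ℝ) :
    ‖Complex.exp (freqForm k v)‖ = 1 := by
  rw [freqForm_apply, Complex.norm_exp]
  simp

theorem norm_expSeries_comp_freqForm_le {n : ℕ} (k : Fin n → ℤ) (m : ℕ) :
    ‖(NormedSpace.expSeries ℝ ℂ m).compContinuousLinearMap fun _ => freqForm k‖ ≤
      ‖freqForm k‖ ^ m / m.factorial := by
  refine (ContinuousMultilinearMap.norm_compContinuousLinearMap_le _ _).trans ?_
  rw [NormedSpace.expSeries, norm_smul, ContinuousMultilinearMap.norm_mkPiAlgebraFin]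
  simp [div_eq_inv_mul]

theorem hasFPowerSeriesOnBall_exp_freqForm {n : ℕ} (k : Fin n → ℤ) (θ : Fin n → ℝ) (r : ℝ≥0)
    (hr : 0 < r) :
    HasFPowerSeriesOnBall (fun y => Complex.exp (freqForm k y))
      (fun m => Complex.exp (freqForm k θ) •
        (NormedSpace.expSeries ℝ ℂ m).compContinuousLinearMap fun _ => freqForm k) θ r := by
  refine ⟨?_, by simpa using hr, fun {y} _ => ?_⟩
  · refine FormalMultilinearSeries.le_radius_of_summable _ ?_
    refine (Real.summable_pow_div_factorial (‖freqForm k‖ * r)).of_nonneg_of_le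
      (fun m => by positivity) fun m => ?_
    rw [norm_smul, norm_exp_freqForm, one_mul, mul_pow, mul_div_right_comm]
    gcongr
    exact norm_expSeries_comp_freqForm_le k m
  · rw [map_add, Complex.exp_add, Complex.exp_eq_exp_ℂ]
    exact (NormedSpace.expSeries_hasSum_exp (𝕂 := ℝ) (freqForm k y)).const_smul
      (NormedSpace.exp (freqForm k θ))

theorem summable_fourier_powerSeries {n : ℕ} {c : (Fin n → ℤ) → ℂ} {M ρ : ℝ} (hρ : 0 < ρ)
    (hc : ∀ k, ‖c k‖ ≤ M * Real.exp (-ρ * ∑ i, |(k i : ℝ)|)) :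
    Summable fun q : (Fin n → ℤ) × ℕ =>
      ‖c q.1‖ * (‖freqForm q.1‖ * (ρ / (4 * Real.pi))) ^ q.2 / (q.2.factorial : ℝ) := by
  have hπ := Real.pi_pos
  have hexp (k : Fin n → ℤ) : HasSum (fun m : ℕ => ‖c k‖ * (‖freqForm k‖ * (ρ / (4 * Real.pi))) ^ m
      / (m.factorial : ℝ)) (‖c k‖ * Real.exp (‖freqForm k‖ * (ρ / (4 * Real.pi)))) := by
    have := NormedSpace.expSeries_div_hasSum_exp (𝔸 := ℝ) (‖freqForm k‖ * (ρ / (4 * Real.pi)))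
    rw [← Real.exp_eq_exp_ℝ] at this
    simpa [mul_div_assoc] using this.mul_left ‖c k‖
  refine (summable_prod_of_nonneg fun q => by positivity).2 ⟨fun k => (hexp k).summable, ?_⟩
  simp_rw [fun k => (hexp k).tsum_eq]
  refine ((summable_exp_neg_sum_abs (half_pos hρ)).mul_left M).of_nonneg_of_le
    (fun k => by positivity) fun k => ?_
  have h1 : ‖freqForm k‖ * (ρ / (4 * Real.pi)) ≤ ρ / 2 * ∑ i, |(k i : ℝ)| := by
    calc _ ≤ (2 * Real.pi * ∑ j, |(k j : ℝ)|) * (ρ / (4 * Real.pi)) := by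
          gcongr; exact norm_freqForm_le k
      _ = _ := by field_simp; ring
  calc _ ≤ (M * Real.exp (-ρ * ∑ i, |(k i : ℝ)|)) * Real.exp (ρ / 2 * ∑ i, |(k i : ℝ)|) :=
        mul_le_mul (hc k) (Real.exp_le_exp.2 h1) (Real.exp_pos _).le ((norm_nonneg _).trans (hc k))
    _ = _ := by rw [mul_assoc, ← Real.exp_add]; congr 2; ring

/-- A Fourier series with exponentially decaying coefficients is real analytic and may be
differentiated term by term. -/
theorem analyticAt_fourierSeries {n : ℕ} {c : (Fin n → ℤ) → ℂ} {M ρ : ℝ} (hρ : 0 < ρ)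
    (hc : ∀ k, ‖c k‖ ≤ M * Real.exp (-ρ * ∑ i, |(k i : ℝ)|)) (θ ω : Fin n → ℝ) :
    AnalyticAt ℝ (fun y => ∑' k, c k * Complex.exp (freqForm k y)) θ ∧
    HasSum (fun k => c k * freqForm k ω * Complex.exp (freqForm k θ))
      (fderiv ℝ (fun y => ∑' k, c k * Complex.exp (freqForm k y)) θ ω) := by
  have hπ := Real.pi_pos
  obtain ⟨r, hrρ⟩ : ∃ r : ℝ≥0, (r : ℝ) = ρ / (4 * Real.pi) :=
    ⟨⟨ρ / (4 * Real.pi), by positivity⟩, rfl⟩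
  have hr' : (0 : ℝ) < r := by rw [hrρ]; positivity
  have hr : 0 < r := hr'
  let u (k : Fin n → ℤ) : FormalMultilinearSeries ℝ (Fin n → ℝ) ℂ := fun m =>
    c k • Complex.exp (freqForm k θ) •
        (NormedSpace.expSeries ℝ ℂ m).compContinuousLinearMap fun _ => freqForm k
  have hu (k : Fin n → ℤ) (m : ℕ) : ‖u k m‖ ≤ ‖c k‖ * (‖freqForm k‖ ^ m / m.factorial) := by
    simp only [u]
    rw [norm_smul, norm_smul, norm_exp_freqForm, one_mul]
    gcongr
    exact norm_expSeries_comp_freqForm_le k m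
  have hsum : Summable fun q : (Fin n → ℤ) × ℕ => ‖u q.1 q.2‖ * (r : ℝ) ^ q.2 := by
    refine (summable_fourier_powerSeries hρ hc).of_nonneg_of_le (fun q => by positivity) fun q => ?_
    calc _ ≤ ‖c q.1‖ * (‖freqForm q.1‖ ^ q.2 / q.2.factorial) * (r : ℝ) ^ q.2 := by
          gcongr; exact hu _ _
      _ = _ := by rw [mul_pow]; rw [hrρ]; ring
  have hball := hasFPowerSeriesOnBall_tsum hr
    (f := fun k y => c k * Complex.exp (freqForm k y)) (u := u) (x := θ)
    (fun k => (hasFPowerSeriesOnBall_exp_freqForm k θ r hr).const_smul (c := c k)) hsum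
  refine ⟨hball.analyticAt, ?_⟩
  have h1 : Summable fun k => u k 1 := by
    have h2 : Summable fun k => ‖u k 1‖ * (r : ℝ) ^ 1 :=
      hsum.comp_injective (i := fun k : Fin n → ℤ => (k, 1)) (fun a b h => (Prod.ext_iff.1 h).1)
    exact ((summable_mul_right_iff (pow_ne_zero 1 hr'.ne')).1 h2).of_norm
  have hu1 (k : Fin n → ℤ) : u k 1 (fun _ => ω) =
      c k * freqForm k ω * Complex.exp (freqForm k θ) := by
    simp [u, NormedSpace.expSeries]
    ring
  clear_value u
  rw [hball.hasFPowerSeriesAt.hasFDerivAt.fderiv, continuousMultilinearCurryFin1_apply]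
  simp_rw [← hu1]
  have h3 := (ContinuousMultilinearMap.apply ℝ (fun _ : Fin 1 => Fin n → ℝ) ℂ
    (fun _ => ω)).hasSum h1.hasSum
  have h4 : (Fin.snoc 0 ω : Fin 1 → Fin n → ℝ) = fun _ => ω := by
    ext i; simp [Fin.snoc]
  rw [h4]
  exact h3

/-- The cube of side one with corner `a`, half-open. -/
def unitCube {n : ℕ} (a : Fin n → ℝ) : Set (Fin n → ℝ) := {x | ∀ i, x i ∈ Set.Ioc (a i) (a i + 1)}

theorem unitCube_eq_pi {n : ℕ} (a : Fin n → ℝ) :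
    unitCube a = Set.univ.pi fun i => Set.Ioc (a i) (a i + 1) := by
  ext; simp [unitCube]

theorem measurableSet_unitCube {n : ℕ} (a : Fin n → ℝ) : MeasurableSet (unitCube a) := by
  rw [unitCube_eq_pi]
  exact MeasurableSet.univ_pi fun i => measurableSet_Ioc

theorem unitCube_zero_ae_eq {n : ℕ} :
    unitCube (0 : Fin n → ℝ) =ᵐ[volume] Set.Icc (0 : Fin n → ℝ) 1 := by
  rw [unitCube_eq_pi]
  simp only [Pi.zero_apply, zero_add]
  exact Measure.univ_pi_Ioc_ae_eq_Icc (μ := fun _ : Fin n => (volume : Measure ℝ))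
    (f := 0) (g := 1)

theorem mFourier_coe {n : ℕ} (k : Fin n → ℤ) (θ : Fin n → ℝ) :
    UnitAddTorus.mFourier k (fun i => (θ i : UnitAddCircle)) = Complex.exp (freqForm k θ) := by
  simp only [UnitAddTorus.mFourier, ContinuousMap.coe_mk, fourier_coe_apply]
  rw [← Complex.exp_sum, freqForm_apply, Complex.ofReal_sum, Finset.mul_sum]
  congr 1
  refine Finset.sum_congr rfl fun i _ => ?_
  push_cast
  ring

theorem exists_lift_unitAddTorus {n : ℕ} {f : (Fin n → ℝ) → ℂ} (hf : Continuous f)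
    (hper : ∀ (θ : Fin n → ℝ) (k : Fin n → ℤ), f (θ + fun i => (k i : ℝ)) = f θ) :
    ∃ F : C(UnitAddTorus (Fin n), ℂ), ∀ θ : Fin n → ℝ, F (fun i => (θ i : UnitAddCircle)) = f θ := by
  have hq : IsOpenQuotientMap
      (fun (x : Fin n → ℝ) (i : Fin n) => (x i : UnitAddCircle)) :=
    IsOpenQuotientMap.piMap (fun _ : Fin n => QuotientAddGroup.isOpenQuotientMap_mk)
  let π : C(Fin n → ℝ, UnitAddTorus (Fin n)) := ⟨_, hq.continuous⟩
  have hπ : Topology.IsQuotientMap π := hq.isQuotientMap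
  have hfac : Function.FactorsThrough f π := by
    intro a b hab
    have h (i : Fin n) : ∃ m : ℤ, a i + m = b i := by
      have h1 : (a i : UnitAddCircle) = b i := congrFun hab i
      obtain ⟨m, hm⟩ := AddSubgroup.mem_zmultiples_iff.1 (QuotientAddGroup.eq.1 h1)
      refine ⟨m, ?_⟩
      simp only [zsmul_eq_mul, mul_one] at hm
      rw [hm]; ring
    choose m hm using h
    rw [← hper a m]
    congr 1
    exact funext hm
  exact ⟨hπ.lift ⟨f, hf⟩ hfac,
    fun θ => congrFun (congrArg DFunLike.coe (hπ.lift_comp ⟨f, hf⟩ hfac)) θ⟩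

/-- Integrals of periodic functions over the unit cube are invariant under translation. -/
theorem setIntegral_unitCube_add {n : ℕ} (F : UnitAddTorus (Fin n) → ℂ) (w : Fin n → ℝ) :
    ∫ x in unitCube (0 : Fin n → ℝ), F (fun i => ((x + w) i : ℝ)) =
      ∫ x in unitCube (0 : Fin n → ℝ), F (fun i => (x i : ℝ)) := by
  have h1 := (UnitAddTorus.integral_preimage F w).symm.trans (UnitAddTorus.integral_preimage F 0)
  refine Eq.trans ?_ h1
  have h2 := (measurePreserving_add_right (volume : Measure (Fin n → ℝ)) w).setIntegral_preimage_emb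
    (measurableEmbedding_addRight w) (fun x => F (fun i => (x i : ℝ))) (unitCube w)
  refine Eq.trans ?_ h2
  congr 2
  ext x
  simp [unitCube, add_comm]

theorem integral_translate_mul_exp_freqForm {n : ℕ} (F : C(UnitAddTorus (Fin n), ℂ)) (k : Fin n → ℤ)
    (w : Fin n → ℝ) :
    ∫ x in unitCube (0 : Fin n → ℝ), F (fun i => ((x + w) i : ℝ)) * Complex.exp (-freqForm k x) =
      Complex.exp (freqForm k w) * UnitAddTorus.mFourierCoeff F k := by
  have hneg (x : Fin n → ℝ) : freqForm (-k) x = -freqForm k x := by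
    simp [freqForm_apply]
  have h0 := UnitAddTorus.mFourierCoeff_eq_integral F k 0
  have h1 := setIntegral_unitCube_add (fun t => UnitAddTorus.mFourier (-k) t • F t) w
  rw [h0]
  change _ = _ * (∫ x in unitCube (0 : Fin n → ℝ), _)
  rw [← h1, ← integral_const_mul]
  congr 1
  ext x
  rw [mFourier_coe, hneg, map_add, smul_eq_mul, ← mul_assoc, ← Complex.exp_add, mul_comm]
  congr 2
  ring

theorem coeff_eq_of_hasSum_exp_mul {a : ℂ} {A : ℕ → ℂ} {c : ℂ} {r : ℝ} (hr : 0 < r)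
    (h : ∀ t : ℝ, |t| < r → HasSum (fun m => (t : ℂ) ^ m * A m) (Complex.exp (t * a) * c)) (m : ℕ) :
    A m = a ^ m / m.factorial * c := by
  let p (B : ℕ → ℂ) : FormalMultilinearSeries ℝ ℝ ℂ := fun m =>
    ContinuousMultilinearMap.mkPiRing ℝ (Fin m) (B m)
  have hp (B : ℕ → ℂ) (m : ℕ) : (p B).coeff m = B m := by
    simp [p, FormalMultilinearSeries.coeff]
  have h1 : HasFPowerSeriesAt (fun t : ℝ => Complex.exp (t * a) * c) (p A) 0 := by
    rw [hasFPowerSeriesAt_iff]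
    filter_upwards [Metric.ball_mem_nhds (0 : ℝ) hr] with t ht
    simpa [hp] using h t (by simpa using ht)
  have h2 : HasFPowerSeriesAt (fun t : ℝ => Complex.exp (t * a) * c)
      (p fun m => a ^ m / m.factorial * c) 0 := by
    rw [hasFPowerSeriesAt_iff]
    refine Filter.Eventually.of_forall fun t => ?_
    have := (NormedSpace.expSeries_div_hasSum_exp ((t : ℂ) * a)).mul_right c
    rw [← Complex.exp_eq_exp_ℂ] at this
    simpa [hp, mul_pow, mul_div_assoc, mul_assoc] using this
  rw [← hp A m, h1.eq_formalMultilinearSeries h2, hp]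

/-- The directional Taylor coefficients of a real analytic function decay geometrically, uniformly
on compact sets and over unit directions. -/
theorem exists_uniform_taylor_bound {E F : Type*} [NormedAddCommGroup E] [NormedSpace ℝ E]
    [NormedAddCommGroup F] [NormedSpace ℝ F] [CompleteSpace F] {f : E → F} {K : Set E}
    (hK : IsCompact K) (hf : ∀ x ∈ K, AnalyticAt ℝ f x) :
    ∃ r C : ℝ, 0 < r ∧ ∀ y ∈ K, ∀ v : E, ‖v‖ ≤ 1 →
      (∀ m : ℕ, ‖(m.factorial : ℝ)⁻¹ • iteratedFDeriv ℝ m f y fun _ => v‖ ≤ C / r ^ m) ∧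
      ∀ t : ℝ, |t| < r → HasSum (fun m : ℕ => t ^ m • ((m.factorial : ℝ)⁻¹ •
        iteratedFDeriv ℝ m f y fun _ => v)) (f (y + t • v)) := by
  obtain ⟨r, C, hr, h⟩ := exists_uniform_powerSeries_bound hK hf
  have hr' : (0 : ℝ) < r := hr
  refine ⟨r, C, hr, fun y hy v hv => ?_⟩
  obtain ⟨q, hq, hb⟩ := h y hy
  have hqm (m : ℕ) : (m.factorial : ℝ)⁻¹ • iteratedFDeriv ℝ m f y (fun _ => v) =
      q m fun _ => v := by
    rw [← hq.factorial_smul v m, ← Nat.cast_smul_eq_nsmul ℝ, smul_smul,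
      inv_mul_cancel₀ (by positivity), one_smul]
  simp_rw [hqm]
  refine ⟨fun m => ?_, fun t ht => ?_⟩
  · rw [le_div_iff₀ (by positivity)]
    have h1 : ‖q m fun _ => v‖ ≤ ‖q m‖ := by
      refine ((q m).le_opNorm _).trans (mul_le_of_le_one_right (norm_nonneg _) ?_)
      simpa using pow_le_one₀ (norm_nonneg v) hv
    calc _ ≤ ‖q m‖ * (r : ℝ) ^ m := by gcongr
      _ ≤ C := by exact_mod_cast hb m
  · have hmem : t • v ∈ Metric.eball (0 : E) r := by
      have : ‖t • v‖ < r := by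
        rw [norm_smul]
        exact (mul_le_of_le_one_right (norm_nonneg _) hv).trans_lt (by simpa using ht)
      simpa using this
    convert hq.hasSum hmem using 2 with m
    rw [ContinuousMultilinearMap.map_smul_univ]
    simp

theorem norm_integral_taylor_le {n : ℕ} {a : (Fin n → ℝ) → ℂ} {B : ℝ} {k : Fin n → ℤ}
    (ha : ∀ x ∈ unitCube (0 : Fin n → ℝ), ‖a x‖ ≤ B) :
    ‖∫ x in unitCube (0 : Fin n → ℝ), a x * Complex.exp (-freqForm k x)‖ ≤ B := by
  have hvol : volume (unitCube (0 : Fin n → ℝ)) = 1 := by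
    rw [unitCube_eq_pi, volume_pi_pi]; simp
  have := norm_setIntegral_le_of_norm_le_const (μ := volume) (s := unitCube (0 : Fin n → ℝ))
    (f := fun x => a x * Complex.exp (-freqForm k x)) (C := B) (by simp [hvol]) fun x hx => by
      rw [norm_mul, Complex.exp_neg, norm_inv, norm_exp_freqForm]
      simpa using ha x hx
  simpa [Measure.real, hvol] using this

/-- The Fourier coefficients of a real analytic function decay exponentially. -/
theorem norm_mFourierCoeff_le {n : ℕ} {F : C(UnitAddTorus (Fin n), ℂ)} {f : (Fin n → ℝ) → ℂ}
    (hF : ∀ θ : Fin n → ℝ, F (fun i => (θ i : UnitAddCircle)) = f θ)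
    (hf : ∀ θ, AnalyticAt ℝ f θ) :
    ∃ M ρ : ℝ, 0 < ρ ∧ ∀ k, ‖UnitAddTorus.mFourierCoeff F k‖ ≤
      M * Real.exp (-ρ * ∑ i, |(k i : ℝ)|) := by
  have hπ := Real.pi_pos
  obtain ⟨r, C, hr, h⟩ := exists_uniform_taylor_bound
    (isCompact_Icc (a := (0 : Fin n → ℝ)) (b := 1)) fun x _ => hf x
  have hsub : unitCube (0 : Fin n → ℝ) ⊆ Set.Icc 0 1 := fun x hx =>
    ⟨fun i => (hx i).1.le, fun i => by simpa using (hx i).2⟩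
  refine ⟨2 * C, Real.pi * r, by positivity, fun k => ?_⟩
  let v : Fin n → ℝ := fun i => SignType.sign (k i : ℝ)
  set N : ℝ := ∑ i, |(k i : ℝ)| with hN
  have hN0 : 0 ≤ N := by positivity
  have hv : ‖v‖ ≤ 1 := (pi_norm_le_iff_of_nonneg zero_le_one).2 fun i => by
    simp only [v]
    cases SignType.sign (k i : ℝ) <;> simp
  have hkv : freqForm k v = 2 * Real.pi * Complex.I * N := by
    rw [freqForm_apply]
    simp only [v, hN, self_mul_sign]
  let a (m : ℕ) (x : Fin n → ℝ) : ℂ :=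
    (m.factorial : ℝ)⁻¹ • iteratedFDeriv ℝ m f x fun _ => v
  have hacont (m : ℕ) : Continuous (a m) := by
    have hsm : ContDiff ℝ m f := contDiff_iff_contDiffAt.2 fun x => (hf x).contDiffAt
    have h1 := hsm.continuous_iteratedFDeriv (m := m) le_rfl
    have h2 : Continuous fun x => iteratedFDeriv ℝ m f x fun _ => v :=
      (ContinuousMultilinearMap.apply ℝ (fun _ : Fin m => Fin n → ℝ) ℂ
        (fun _ => v)).continuous.comp h1
    exact h2.const_smul (m.factorial : ℝ)⁻¹
  have hab (m : ℕ) : ∀ x ∈ unitCube (0 : Fin n → ℝ), ‖a m x‖ ≤ C / r ^ m := fun x hx =>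
    (h x (hsub hx) v hv).1 m
  let A (m : ℕ) : ℂ := ∫ x in unitCube (0 : Fin n → ℝ), a m x * Complex.exp (-freqForm k x)
  have hA (m : ℕ) : ‖A m‖ ≤ C / r ^ m := norm_integral_taylor_le (hab m)
  have hsum (t : ℝ) (ht : |t| < r) : HasSum (fun m => (t : ℂ) ^ m * A m)
      (Complex.exp (t * freqForm k v) * UnitAddTorus.mFourierCoeff F k) := by
    have hfour := integral_translate_mul_exp_freqForm F k (t • v)
    rw [map_smul, Complex.real_smul] at hfour
    rw [← hfour]
    simp_rw [A, ← integral_const_mul]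
    have hexp (x : Fin n → ℝ) : ‖Complex.exp (-freqForm k x)‖ = 1 := by
      rw [Complex.exp_neg, norm_inv, norm_exp_freqForm, inv_one]
    refine hasSum_integral_of_dominated_convergence (fun m _ => C * (|t| / r) ^ m)
      (fun m => ?_) (fun m => ?_) ?_ ?_ ?_
    · refine Continuous.aestronglyMeasurable ?_
      have := hacont m
      fun_prop
    · filter_upwards [ae_restrict_mem (measurableSet_unitCube 0)] with x hx
      rw [norm_mul, norm_mul, hexp, mul_one, norm_pow, Complex.norm_real, Real.norm_eq_abs]
      calc _ ≤ |t| ^ m * (C / r ^ m) := by gcongr; exact hab m x hx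
        _ = _ := by rw [div_pow]; ring
    · refine Filter.Eventually.of_forall fun x => ?_
      exact (summable_geometric_of_lt_one (by positivity) ((div_lt_one hr).2 ht)).mul_left C
    · refine integrableOn_const ?_ (by simp)
      rw [unitCube_eq_pi, volume_pi_pi]; simp
    · filter_upwards [ae_restrict_mem (measurableSet_unitCube 0)] with x hx
      rw [hF]
      convert! ((h x (hsub hx) v hv).2 t ht).mul_right (Complex.exp (-freqForm k x)) using 2 with m
      simp only [a, Complex.real_smul]
      push_cast
      ring
  set c := UnitAddTorus.mFourierCoeff F k
  have hterm (m : ℕ) : (Real.pi * r * N) ^ m / m.factorial * ‖c‖ ≤ C * (1 / 2) ^ m := by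
    have h1 := hA m
    rw [coeff_eq_of_hasSum_exp_mul hr hsum m, hkv] at h1
    simp only [norm_mul, norm_div, norm_pow, Complex.norm_ofNat, Complex.norm_real,
      Complex.norm_I, Complex.norm_natCast, Real.norm_eq_abs, abs_of_pos hπ, abs_of_nonneg hN0,
      mul_one] at h1
    rw [le_div_iff₀ (by positivity)] at h1
    calc _ = (2 * Real.pi * N) ^ m / m.factorial * ‖c‖ * r ^ m * (1 / 2) ^ m := by
          simp only [mul_pow, one_div, inv_pow]; field_simp
      _ ≤ _ := by gcongr
  have hle := hasSum_le hterm
    ((NormedSpace.expSeries_div_hasSum_exp (Real.pi * r * N)).mul_right ‖c‖)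
    (hasSum_geometric_two.mul_left C)
  rw [← Real.exp_eq_exp_ℝ] at hle
  rw [neg_mul, Real.exp_neg, ← div_eq_mul_inv, le_div_iff₀ (Real.exp_pos _)]
  linarith

/-- A real analytic periodic function is the sum of its Fourier series, with exponentially decaying
coefficients. -/
theorem exists_fourierSeries {n : ℕ} {f : (Fin n → ℝ) → ℂ} (hf : ∀ θ, AnalyticAt ℝ f θ)
    (hper : ∀ (θ : Fin n → ℝ) (k : Fin n → ℤ), f (θ + fun i => (k i : ℝ)) = f θ) :
    ∃ (c : (Fin n → ℤ) → ℂ) (M ρ : ℝ), 0 < ρ ∧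
      (∀ k, ‖c k‖ ≤ M * Real.exp (-ρ * ∑ i, |(k i : ℝ)|)) ∧
      c 0 = ∫ x in Set.Icc (0 : Fin n → ℝ) 1, f x ∧
      ∀ θ, HasSum (fun k => c k * Complex.exp (freqForm k θ)) (f θ) := by
  have hcont : Continuous f := continuous_iff_continuousAt.2 fun x => (hf x).continuousAt
  obtain ⟨F, hF⟩ := exists_lift_unitAddTorus hcont hper
  obtain ⟨M, ρ, hρ, hM⟩ := norm_mFourierCoeff_le hF hf
  refine ⟨UnitAddTorus.mFourierCoeff F, M, ρ, hρ, hM, ?_, fun θ => ?_⟩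
  · have h := integral_translate_mul_exp_freqForm F 0 0
    simp only [freqForm_apply, hF] at h
    rw [← setIntegral_congr_set unitCube_zero_ae_eq]
    simpa using h.symm
  · have hs : Summable (UnitAddTorus.mFourierCoeff F) :=
      ((summable_exp_neg_sum_abs hρ).mul_left M).of_norm_bounded hM
    have := UnitAddTorus.hasSum_mFourier_series_apply_of_summable hs fun i => (θ i : UnitAddCircle)
    simpa only [mFourier_coe, smul_eq_mul, hF] using this

theorem exp_freqForm_add_int {n : ℕ} (k : Fin n → ℤ) (θ : Fin n → ℝ) (m : Fin n → ℤ) :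
    Complex.exp (freqForm k (θ + fun i => (m i : ℝ))) = Complex.exp (freqForm k θ) := by
  have h : freqForm k (fun i => (m i : ℝ)) =
      ((∑ j, k j * m j : ℤ) : ℂ) * (2 * Real.pi * Complex.I) := by
    rw [freqForm_apply]
    push_cast
    ring
  rw [map_add, Complex.exp_add, h, Complex.exp_int_mul_two_pi_mul_I, mul_one]

theorem rpow_le_mul_exp {σ a x : ℝ} (hσ : 0 < σ) (ha : 0 < a) (hx : 0 ≤ x) :
    x ^ σ ≤ (σ / a) ^ σ * Real.exp (a * x) := by
  have h1 : x ≤ σ / a * Real.exp (a * x / σ) := by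
    have h2 := Real.add_one_le_exp (a * x / σ)
    calc x = σ / a * (a * x / σ) := by field_simp
      _ ≤ _ := by gcongr; linarith
  calc x ^ σ ≤ (σ / a * Real.exp (a * x / σ)) ^ σ := by gcongr
    _ = _ := by
      rw [Real.mul_rpow (by positivity) (by positivity), ← Real.exp_mul]
      congr 2
      field_simp

/-- Division by the small divisors `2πi k·ω` preserves exponential decay. -/
theorem IsDiophantine.norm_div_freqForm_le {n : ℕ} {γ σ : ℝ} (hγ : 0 < γ) (hσ : 0 < σ)
    {ω : Fin n → ℝ} (hω : IsDiophantine γ σ ω) {c : (Fin n → ℤ) → ℂ} {M ρ : ℝ} (hρ : 0 < ρ)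
    (hc : ∀ k, ‖c k‖ ≤ M * Real.exp (-ρ * ∑ i, |(k i : ℝ)|)) (hc0 : c 0 = 0) (k : Fin n → ℤ) :
    freqForm k ω = 0 ∧ c k = 0 ∨ freqForm k ω ≠ 0 ∧
      ‖c k / freqForm k ω‖ ≤ (M * (σ / (ρ / 2)) ^ σ / (2 * Real.pi * γ)) *
        Real.exp (-(ρ / 2) * ∑ i, |(k i : ℝ)|) := by
  have hπ := Real.pi_pos
  rcases eq_or_ne k 0 with rfl | hk
  · exact Or.inl ⟨by simp [freqForm_apply], hc0⟩
  have hN : 0 < ∑ i, |(k i : ℝ)| := by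
    obtain ⟨i, hi⟩ := Function.ne_iff.1 hk
    refine Finset.sum_pos' (fun _ _ => abs_nonneg _) ⟨i, Finset.mem_univ i, ?_⟩
    simpa using hi
  have hk' := hc k
  have hd := hω k hk
  set N : ℝ := ∑ i, |(k i : ℝ)|
  have hnorm : ‖freqForm k ω‖ = 2 * Real.pi * |∑ i, (k i : ℝ) * ω i| := by
    rw [freqForm_apply]
    simp [abs_of_pos hπ, -Complex.ofReal_sum]
  have hpos : 0 < 2 * Real.pi * (γ * N ^ (-σ)) := by positivity
  have hlow : 2 * Real.pi * (γ * N ^ (-σ)) ≤ ‖freqForm k ω‖ := by rw [hnorm]; gcongr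
  refine Or.inr ⟨norm_pos_iff.1 (hpos.trans_le hlow), ?_⟩
  have hM : 0 ≤ M := nonneg_of_mul_nonneg_left ((norm_nonneg _).trans hk') (Real.exp_pos _)
  rw [norm_div]
  calc ‖c k‖ / ‖freqForm k ω‖ ≤ M * Real.exp (-ρ * N) / (2 * Real.pi * (γ * N ^ (-σ))) := by
        gcongr
    _ = M * Real.exp (-ρ * N) * N ^ σ / (2 * Real.pi * γ) := by
        rw [Real.rpow_neg hN.le]
        field_simp
    _ ≤ M * Real.exp (-ρ * N) * ((σ / (ρ / 2)) ^ σ * Real.exp (ρ / 2 * N)) / (2 * Real.pi * γ) := by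
        gcongr
        exact rpow_le_mul_exp hσ (half_pos hρ) hN.le
    _ = M * (σ / (ρ / 2)) ^ σ / (2 * Real.pi * γ) * (Real.exp (-ρ * N) * Real.exp (ρ / 2 * N)) := by
        ring
    _ = _ := by
        rw [← Real.exp_add]
        congr 2
        ring

/-- The scalar cohomological equation `∂_ω g = f` over a Diophantine frequency. -/
theorem IsDiophantine.exists_primitive {n : ℕ} {γ σ : ℝ} (hγ : 0 < γ) (hσ : 0 < σ)
    {ω : Fin n → ℝ} (hω : IsDiophantine γ σ ω) {f : (Fin n → ℝ) → ℝ}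
    (hf : ∀ θ, AnalyticAt ℝ f θ)
    (hper : ∀ (θ : Fin n → ℝ) (k : Fin n → ℤ), f (θ + fun i => (k i : ℝ)) = f θ)
    (havg : ∫ x in Set.Icc (0 : Fin n → ℝ) 1, f x = 0) :
    ∃ g : (Fin n → ℝ) → ℝ, (∀ θ, AnalyticAt ℝ g θ) ∧
      (∀ (θ : Fin n → ℝ) (k : Fin n → ℤ), g (θ + fun i => (k i : ℝ)) = g θ) ∧
      ∀ θ, fderiv ℝ g θ ω = f θ := by
  obtain ⟨c, M, ρ, hρ, hc, hc0, hsum⟩ := exists_fourierSeries (f := fun θ => (f θ : ℂ))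
    (fun θ => (Complex.ofRealCLM.analyticAt _).comp (hf θ)) (fun θ k => by rw [hper])
  rw [integral_complex_ofReal, havg, Complex.ofReal_zero] at hc0
  have hM : 0 ≤ M :=
    nonneg_of_mul_nonneg_left ((norm_nonneg _).trans (hc 0)) (Real.exp_pos _)
  have hdiv := hω.norm_div_freqForm_le hγ hσ hρ hc hc0
  have hd (k : Fin n → ℤ) : ‖c k / freqForm k ω‖ ≤ (M * (σ / (ρ / 2)) ^ σ / (2 * Real.pi * γ)) *
        Real.exp (-(ρ / 2) * ∑ i, |(k i : ℝ)|) := by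
    rcases hdiv k with ⟨-, h⟩ | ⟨-, h⟩
    · rw [h, zero_div, norm_zero]
      have := Real.pi_pos
      positivity
    · exact h
  have hG := fun θ => analyticAt_fourierSeries (half_pos hρ) hd θ ω
  set G : (Fin n → ℝ) → ℂ := fun y =>
    ∑' k, c k / freqForm k ω * Complex.exp (freqForm k y) with hGdef
  refine ⟨fun θ => (G θ).re, fun θ => (Complex.reCLM.analyticAt _).comp (hG θ).1, fun θ k => ?_,
    fun θ => ?_⟩
  · simp only [hGdef, exp_freqForm_add_int]
  · have h1 : fderiv ℝ G θ ω = f θ := by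
      refine (hG θ).2.unique ?_
      convert hsum θ using 2 with k
      rcases hdiv k with ⟨h0, h⟩ | ⟨h0, -⟩
      · simp [h]
      · rw [div_mul_cancel₀ _ h0]
    have h2 : HasFDerivAt (fun θ => (G θ).re) (Complex.reCLM.comp (fderiv ℝ G θ)) θ :=
      Complex.reCLM.hasFDerivAt.comp θ (hG θ).1.differentiableAt.hasFDerivAt
    rw [h2.fderiv, ContinuousLinearMap.comp_apply, h1]
    simp

/-- The vector-valued version of `IsDiophantine.exists_primitive`. -/
theorem IsDiophantine.exists_primitive_pi {n : ℕ} {γ σ : ℝ} (hγ : 0 < γ) (hσ : 0 < σ)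
    {ω : Fin n → ℝ} (hω : IsDiophantine γ σ ω) {f : (Fin n → ℝ) → Fin n → ℝ}
    (hf : ∀ θ, AnalyticAt ℝ f θ)
    (hper : ∀ (θ : Fin n → ℝ) (k : Fin n → ℤ), f (θ + fun i => (k i : ℝ)) = f θ)
    (havg : ∫ x in Set.Icc (0 : Fin n → ℝ) 1, f x = 0) :
    ∃ g : (Fin n → ℝ) → Fin n → ℝ, (∀ θ, AnalyticAt ℝ g θ) ∧
      (∀ (θ : Fin n → ℝ) (k : Fin n → ℤ), g (θ + fun i => (k i : ℝ)) = g θ) ∧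
      ∀ θ, fderiv ℝ g θ ω = f θ := by
  have hcont : Continuous f := continuous_iff_continuousAt.2 fun x => (hf x).continuousAt
  have h (i : Fin n) := hω.exists_primitive hγ hσ (f := fun θ => f θ i)
    (fun θ => analyticAt_pi_iff.1 (hf θ) i) (fun θ k => by rw [hper])
    (by
      rw [← eval_integral (fun j => ?_) i, havg, Pi.zero_apply]
      exact (Continuous.integrableOn_Icc (by fun_prop)))
  choose g hg hgper hgd using h
  have hga (θ : Fin n → ℝ) : AnalyticAt ℝ (fun θ i => g i θ) θ := AnalyticAt.pi fun i => hg i θ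
  refine ⟨fun θ i => g i θ, hga, fun θ k => funext fun i => hgper i θ k, fun θ => ?_⟩
  ext i
  rw [← hgd i θ, fderiv_pi fun i => (hg i θ).differentiableAt]
  rfl

/-- Solvability of the reduced upper-triangular linearized equation:
for Diophantine `ω`, real analytic `ℤⁿ`-periodic `S⁰` with invertible average and real
analytic `ℤⁿ`-periodic `p_x, p_y` with `p_y` of zero average, there exist real analytic
`ℤⁿ`-periodic `ξ_x, ξ_y` with `∂_ω ξ_y = −p_y` and `∂_ω ξ_x = S⁰ ξ_y − p_x`. -/
theorem stmt_19 {n : ℕ} (γ σ : ℝ) (hγ : 0 < γ) (hσ : 0 < σ)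
    (ω : Fin n → ℝ) (hω : IsDiophantine γ σ ω)
    (S : (Fin n → ℝ) → Matrix (Fin n) (Fin n) ℝ)
    (hSan : ∀ θ, ∀ i j, AnalyticAt ℝ (fun θ' => S θ' i j) θ)
    (hSper : ∀ (θ : Fin n → ℝ) (k : Fin n → ℤ), S (θ + fun i => (k i : ℝ)) = S θ)
    (hSavg : IsUnit (Matrix.of fun (i j : Fin n) =>
      ∫ x in Set.Icc (0 : Fin n → ℝ) 1, S x i j))
    (px py : (Fin n → ℝ) → (Fin n → ℝ))
    (hpxan : ∀ θ, AnalyticAt ℝ px θ) (hpyan : ∀ θ, AnalyticAt ℝ py θ)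
    (hpxper : ∀ (θ : Fin n → ℝ) (k : Fin n → ℤ), px (θ + fun i => (k i : ℝ)) = px θ)
    (hpyper : ∀ (θ : Fin n → ℝ) (k : Fin n → ℤ), py (θ + fun i => (k i : ℝ)) = py θ)
    (hpyavg : (∫ x in Set.Icc (0 : Fin n → ℝ) 1, py x) = 0) :
    ∃ ξx ξy : (Fin n → ℝ) → (Fin n → ℝ),
      (∀ θ, AnalyticAt ℝ ξx θ) ∧ (∀ θ, AnalyticAt ℝ ξy θ) ∧
      (∀ (θ : Fin n → ℝ) (k : Fin n → ℤ), ξx (θ + fun i => (k i : ℝ)) = ξx θ) ∧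
      (∀ (θ : Fin n → ℝ) (k : Fin n → ℤ), ξy (θ + fun i => (k i : ℝ)) = ξy θ) ∧
      (∀ θ, fderiv ℝ ξy θ ω = -py θ) ∧
      (∀ θ, fderiv ℝ ξx θ ω = (S θ).mulVec (ξy θ) - px θ) := by
  obtain ⟨η, hη, hηper, hηd⟩ := hω.exists_primitive_pi hγ hσ (f := fun θ => -py θ)
    (fun θ => (hpyan θ).neg) (fun θ k => by rw [hpyper]) (by rw [integral_neg, hpyavg, neg_zero])
  have cont {f : (Fin n → ℝ) → Fin n → ℝ} (hf : ∀ θ, AnalyticAt ℝ f θ) : Continuous f :=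
    continuous_iff_continuousAt.2 fun x => (hf x).continuousAt
  have hSc (i j : Fin n) : Continuous fun θ => S θ i j :=
    continuous_iff_continuousAt.2 fun x => (hSan x i j).continuousAt
  set A : Matrix (Fin n) (Fin n) ℝ :=
    Matrix.of fun (i j : Fin n) => ∫ x in Set.Icc (0 : Fin n → ℝ) 1, S x i j with hA
  have hmulan {ξ : (Fin n → ℝ) → Fin n → ℝ} (hξ : ∀ θ, AnalyticAt ℝ ξ θ) (θ : Fin n → ℝ) :
      AnalyticAt ℝ (fun θ => (S θ).mulVec (ξ θ)) θ := by
    refine AnalyticAt.pi fun i => ?_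
    simp only [Matrix.mulVec, dotProduct]
    exact Finset.analyticAt_fun_sum _ fun j _ => (hSan θ i j).mul (analyticAt_pi_iff.1 (hξ θ) j)
  have hint {f : (Fin n → ℝ) → Fin n → ℝ} (hf : ∀ θ, AnalyticAt ℝ f θ) :
      IntegrableOn f (Set.Icc 0 1) := (cont hf).integrableOn_Icc
  have hconst (a : Fin n → ℝ) :
      ∫ x in Set.Icc (0 : Fin n → ℝ) 1, (S x).mulVec a = A.mulVec a := by
    ext i
    rw [eval_integral fun j => ?_]
    · simp only [Matrix.mulVec, dotProduct, hA, Matrix.of_apply]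
      rw [integral_finsetSum _ fun j _ => ?_]
      · simp_rw [integral_mul_const]
      · exact ((hSc i j).mul continuous_const).integrableOn_Icc
    · exact (((continuous_apply j).comp
        (cont (hmulan fun θ => analyticAt_const (v := a)))).integrableOn_Icc)
  set b : Fin n → ℝ := ∫ x in Set.Icc (0 : Fin n → ℝ) 1, ((S x).mulVec (η x) - px x)
  set a : Fin n → ℝ := -(A⁻¹.mulVec b)
  have hAa : A.mulVec a = -b := by
    rw [Matrix.mulVec_neg, Matrix.mulVec_mulVec,
      Matrix.mul_nonsing_inv _ ((Matrix.isUnit_iff_isUnit_det _).1 hSavg), Matrix.one_mulVec]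
  have hξy (θ : Fin n → ℝ) : AnalyticAt ℝ (fun θ => η θ + a) θ := (hη θ).add analyticAt_const
  have hrhs (θ : Fin n → ℝ) : AnalyticAt ℝ (fun θ => (S θ).mulVec (η θ) - px θ) θ :=
    (hmulan hη θ).sub (hpxan θ)
  obtain ⟨ξ, hξ, hξper, hξd⟩ := hω.exists_primitive_pi hγ hσ
    (f := fun θ => (S θ).mulVec (η θ + a) - px θ)
    (fun θ => (hmulan hξy θ).sub (hpxan θ)) (fun θ k => by rw [hSper, hηper, hpxper])
    (by
      simp_rw [Matrix.mulVec_add, add_sub_right_comm]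
      rw [integral_add (hint hrhs) (hint (hmulan fun θ => analyticAt_const)), hconst, hAa,
        add_neg_cancel])
  refine ⟨ξ, fun θ => η θ + a, hξ, hξy, hξper, fun θ k => ?_, fun θ => ?_, hξd⟩
  · simp only [hηper]
  · rw [fderiv_add_const, hηd]
end
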